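/- Every graph H without isolated vertices admits a decomposition of its vertex set into vertex-disjoint subgraphs that are odd cycles C̄_1, …, C̄_α and stars S̄_1, …, S̄_β (with all edges of these subgraphs being edges of H, and every vertex of H in exactly one of them) such that ρ(H) = ∑_{i=1}^α ρ(C̄_i) + ∑_{j=1}^β ρ(S̄_j), where ρ denotes the fractional edge-cover number. -/

import Mathlib

/-- The fractional edge-cover number of a graph `H`. -/
noncomputable def fracEdgeCoverNum {V : Type*} [Fintype V] [DecidableEq V]
    (H : SimpleGraph V) : ℝ :=
  sInf {x : ℝ | ∃ ψ : Sym2 V → ℝ, (∀ e, 0 ≤ ψ e ∧ ψ e ≤ 1) ∧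
    (∀ e, e ∉ H.edgeSet → ψ e = 0) ∧
    (∀ v : V, 1 ≤ ∑ e : Sym2 V, if v ∈ e then ψ e else 0) ∧
    x = ∑ e : Sym2 V, ψ e}


namespace EC

open Finset

set_option linter.unusedSectionVars false

variable {V : Type*} [Fintype V] [DecidableEq V]

/-- `A` is the vertex set of an odd cycle of `H`. -/
def IsCyc (H : SimpleGraph V) (A : Finset V) : Prop :=
  ∃ (c : ℕ) (f : ZMod c → V), Odd c ∧ 3 ≤ c ∧ Function.Injective f ∧
    (∀ a, H.Adj (f a) (f (a + 1))) ∧ (A : Set V) = Set.range f ∧ A.card = c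

/-- `A` is the vertex set of a star of `H`. -/
def IsStar (H : SimpleGraph V) (A : Finset V) : Prop :=
  ∃ (c : V) (L : Finset V), A = insert c L ∧ c ∉ L ∧ L.Nonempty ∧ ∀ w ∈ L, H.Adj c w

/-- `S` splits into odd cycles and stars of total doubled value `x`. -/
inductive D (H : SimpleGraph V) : Finset V → ℕ → Prop
  | empty : D H ∅ 0
  | cyc {S A : Finset V} {x : ℕ} : IsCyc H A → Disjoint A S → D H S x → D H (A ∪ S) (A.card + x)
  | star {S A : Finset V} {x : ℕ} :
      IsStar H A → Disjoint A S → D H S x → D H (A ∪ S) (2 * (A.card - 1) + x)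

variable {H : SimpleGraph V}

lemma D.union {S T : Finset V} {x y : ℕ} (h1 : D H S x) (h2 : D H T y) (hd : Disjoint S T) :
    D H (S ∪ T) (x + y) := by
  induction h1 with
  | empty => simpa using h2
  | cyc hA hAS _ ih =>
    rw [disjoint_union_left] at hd
    rw [union_assoc, add_assoc]
    exact D.cyc hA (disjoint_union_right.2 ⟨hAS, hd.1⟩) (ih hd.2)
  | star hA hAS _ ih =>
    rw [disjoint_union_left] at hd
    rw [union_assoc, add_assoc]
    exact D.star hA (disjoint_union_right.2 ⟨hAS, hd.1⟩) (ih hd.2)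

lemma D.ofStar {c : V} {L : Finset V} (h1 : c ∉ L) (h2 : L.Nonempty) (h3 : ∀ w ∈ L, H.Adj c w) :
    D H (insert c L) (2 * L.card) := by
  have := D.star (H := H) (A := insert c L) ⟨c, L, rfl, h1, h2, h3⟩ (disjoint_empty_right _) D.empty
  simpa [card_insert_of_notMem h1] using this

lemma D.edge {u v : V} (h : H.Adj u v) : D H {u, v} 2 := by
  have := D.ofStar (H := H) (c := u) (L := {v}) (by simpa using h.ne) (by simp) (by simpa using h)
  simpa using this

lemma D.path (h : ℕ → V) (m : ℕ) (hinj : Set.InjOn h (Set.Iio (2 * m)))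
    (hadj : ∀ i < 2 * m - 1, H.Adj (h i) (h (i + 1))) : D H ((range (2 * m)).image h) (2 * m) := by
  induction m with
  | zero => simpa using D.empty
  | succ m ih =>
    have h1 := ih (hinj.mono (by intro i; simp; omega)) (fun i hi => hadj i (by omega))
    have h2 := D.edge (hadj (2 * m) (by omega))
    have hd : Disjoint ((range (2 * m)).image h) {h (2 * m), h (2 * m + 1)} := by
      rw [disjoint_left]
      intro a ha hb
      simp only [mem_image, mem_range] at ha
      obtain ⟨i, hi, rfl⟩ := ha
      simp only [mem_insert, mem_singleton] at hb
      rcases hb with hb | hb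
      · have := hinj (by simp; omega) (by simp) hb
        omega
      · have := hinj (by simp; omega) (by simp; omega) hb
        omega
    have h3 := h1.union h2 hd
    rw [show 2 * m + 2 = 2 * (m + 1) by ring] at h3
    convert h3 using 1
    rw [show 2 * (m + 1) = 2 * m + 1 + 1 by ring, range_add_one, range_add_one, image_insert,
      image_insert]
    ext a
    simp
    tauto

lemma IsCyc.erase {A : Finset V} (hA : IsCyc H A) {u : V} (hu : u ∈ A) :
    D H (A.erase u) (A.card - 1) := by
  obtain ⟨c, f, ⟨m, hm⟩, h3, hinj, hadj, hr, hc⟩ := hA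
  have hu' : u ∈ Set.range f := by rw [← hr]; exact hu
  obtain ⟨a, rfl⟩ := hu'
  have key : ∀ i j : ℕ, i < c → j < c → (i : ZMod c) = j → i = j := by
    intro i j hi hj h
    rw [ZMod.natCast_eq_natCast_iff'] at h
    rwa [Nat.mod_eq_of_lt hi, Nat.mod_eq_of_lt hj] at h
  have hI : Set.InjOn (fun i : ℕ => f (a + 1 + i)) (Set.Iio (2 * m)) := by
    intro i hi j hj h
    simp only [Set.mem_Iio] at hi hj
    exact key i j (by omega) (by omega) (add_left_cancel (hinj h))
  have := D.path (H := H) (fun i : ℕ => f (a + 1 + i)) m hI (by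
    intro i _
    have := hadj (a + 1 + i)
    simpa [add_assoc] using this)
  convert this using 1
  · symm
    apply eq_of_subset_of_card_le
    · intro x hx
      simp only [mem_image, mem_range] at hx
      obtain ⟨i, hi, rfl⟩ := hx
      rw [mem_erase]
      refine ⟨fun h => ?_, ?_⟩
      · have h := hinj h
        rw [add_assoc, add_eq_left] at h
        have := key (1 + i) 0 (by omega) (by omega) (by push_cast; exact h)
        omega
      · rw [← mem_coe, hr]; exact ⟨_, rfl⟩
    · rw [card_image_of_injOn (by simpa using hI), card_erase_of_mem hu, card_range]
      omega
  · omega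

lemma D.attach {S : Finset V} {x : ℕ} (h : D H S x) {u v : V} (hv : v ∉ S) (hu : u ∈ S)
    (huv : H.Adj u v) : ∃ y ≤ x + 2, D H (insert v S) y := by
  induction h with
  | empty => simp at hu
  | @cyc S A x hA hAS hS ih =>
    rw [mem_union, not_or] at hv
    by_cases huA : u ∈ A
    · have h1 := hA.erase huA
      have h2 := (h1.union (D.edge huv) (by simp [hv.1])).union hS (by
        simp only [disjoint_union_left, disjoint_insert_left, disjoint_singleton_left]
        exact ⟨disjoint_of_subset_left (erase_subset _ _) hAS, disjoint_left.1 hAS huA, hv.2⟩)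
      refine ⟨A.card - 1 + 2 + x, ?_, ?_⟩
      rotate_left
      · convert h2 using 1
        ext b
        simp only [mem_insert, mem_union, mem_erase, mem_singleton]
        by_cases hb : b = u
        · subst hb; simp [huA]
        · simp [hb]; tauto
      · omega
    · obtain ⟨y, hy, hD⟩ := ih hv.2 ((mem_union.1 hu).resolve_left huA)
      refine ⟨A.card + y, ?_, ?_⟩
      rotate_left
      · rw [← union_insert]
        exact D.cyc hA (by simp [hv.1, hAS]) hD
      · omega
  | @star S A x hA hAS hS ih =>
    rw [mem_union, not_or] at hv
    by_cases huA : u ∈ A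
    · suffices h : ∃ y ≤ 2 * (A.card - 1) + 2, D H (insert v A) y by
        obtain ⟨y, hy, hD⟩ := h
        refine ⟨y + x, by omega, ?_⟩
        rw [← insert_union]
        exact hD.union hS (by simp [hv.2, hAS])
      obtain ⟨c, L, rfl, hcL, hL, hadj⟩ := hA
      have hv1 := hv.1
      rw [mem_insert, not_or] at hv1
      rw [card_insert_of_notMem hcL]
      rcases mem_insert.1 huA with rfl | huL
      · refine ⟨2 * (insert v L).card, ?_, ?_⟩
        rotate_left
        · rw [insert_comm]
          refine D.ofStar (c := u) (L := insert v L) ?_ (by simp) ?_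
          · simp [hcL, huv.ne]
          · simpa [huv] using hadj
        · rw [card_insert_of_notMem hv1.2]
          omega
      · have huc : c ≠ u := (hadj u huL).ne
        by_cases hE : (L.erase u).Nonempty
        · have h1 := D.ofStar (H := H) (c := c) (L := L.erase u) (by simp [hcL]) hE
            (fun w hw => hadj w (mem_of_mem_erase hw))
          have h2 := h1.union (D.edge huv) (by
            simp [hv1, huc.symm])
          refine ⟨2 * (L.erase u).card + 2, ?_, ?_⟩
          rotate_left
          · convert h2 using 1
            ext b
            simp only [mem_insert, mem_union, mem_erase, mem_singleton]
            by_cases hb : b = u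
            · subst hb; simp [huL]
            · simp [hb]; tauto
          · rw [card_erase_of_mem huL]
            omega
        · have hLu : L = {u} := by
            rw [not_nonempty_iff_eq_empty, erase_eq_empty_iff] at hE
            rcases hE with h | h
            · simp [h] at huL
            · exact h
          subst hLu
          refine ⟨2 * ({v, c} : Finset V).card, ?_, ?_⟩
          · rw [card_pair hv1.1]; simp
          · have := D.ofStar (H := H) (c := u) (L := {v, c}) (by simp [huv.ne, huc.symm]) (by simp)
              (by simp [huv, (hadj u (by simp)).symm])
            convert this using 1
            ext b
            simp
            tauto
    · obtain ⟨y, hy, hD⟩ := ih hv.2 ((mem_union.1 hu).resolve_left huA)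
      refine ⟨2 * (A.card - 1) + y, ?_, ?_⟩
      rotate_left
      · rw [← union_insert]
        exact D.star hA (by simp [hv.1, hAS]) hD
      · omega

lemma D.extend (hiso : ∀ v : V, ∃ u, H.Adj v u) (n : ℕ) : ∀ {S : Finset V} {x : ℕ}, D H S x →
    Sᶜ.card = n → ∃ y ≤ x + 2 * n, D H univ y := by
  induction n using Nat.strong_induction_on with
  | _ n ih =>
    intro S x hS hn
    by_cases hE : Sᶜ = ∅
    · rw [compl_eq_empty_iff] at hE
      subst hE
      exact ⟨x, by omega, hS⟩
    · obtain ⟨v, hv⟩ := nonempty_iff_ne_empty.2 hE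
      obtain ⟨u, hu⟩ := hiso v
      rw [mem_compl] at hv
      by_cases huS : u ∈ S
      · obtain ⟨y, hy, hD⟩ := hS.attach hv huS hu.symm
        have hc : (insert v S)ᶜ.card + 1 = n := by
          rw [compl_insert, card_erase_of_mem (by simpa using hv), hn]
          have := card_pos.2 ⟨v, mem_compl.2 hv⟩
          omega
        obtain ⟨z, hz, hz'⟩ := ih _ (by omega) hD rfl
        exact ⟨z, by omega, hz'⟩
      · have hD := (D.edge hu).union hS (by simp [hv, huS])
        have hc : (({v, u} : Finset V) ∪ S)ᶜ.card + 2 = n := by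
          rw [card_compl] at hn ⊢
          rw [card_union_of_disjoint (by simp [hv, huS]), card_pair hu.ne]
          have := card_le_univ (({v, u} : Finset V) ∪ S)
          rw [card_union_of_disjoint (by simp [hv, huS]), card_pair hu.ne] at this
          omega
        obtain ⟨z, hz, hz'⟩ := ih _ (by omega) hD rfl
        exact ⟨z, by omega, hz'⟩

lemma matching (g : V → V) (A : Finset V) : Set.InjOn g A → (∀ a ∈ A, H.Adj a (g a)) →
    ∃ S y, S ⊆ A ∪ A.image g ∧ D H S y ∧ y + A.card ≤ 2 * S.card := by
  induction A using Finset.strongInduction with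
  | _ A ih =>
    intro hinj hadj
    by_cases hE : A = ∅
    · subst hE
      exact ⟨∅, 0, by simp, D.empty, by simp⟩
    by_cases hst : ∃ a ∈ A, a ∉ A.image g
    · obtain ⟨a, ha, hag⟩ := hst
      have hne := (hadj a ha).ne
      have hss : (A.erase a).erase (g a) ⊆ A := (erase_subset _ _).trans (erase_subset _ _)
      obtain ⟨S, y, hS, hD, hy⟩ := ih ((A.erase a).erase (g a))
        (_root_.ssubset_of_subset_of_ssubset (erase_subset _ _) (erase_ssubset ha))
        (hinj.mono (by exact_mod_cast hss)) (fun b hb => hadj b (hss hb))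
      have haS : a ∉ S := by
        intro h
        have := hS h
        rw [mem_union] at this
        rcases this with h | h
        · simp at h
        · exact hag (image_subset_image hss h)
      have hgaS : g a ∉ S := by
        intro h
        have := hS h
        rw [mem_union] at this
        rcases this with h | h
        · simp at h
        · obtain ⟨b, hb, hbe⟩ := mem_image.1 h
          have := hinj (hss hb) ha hbe
          subst this
          simp at hb
      have hdis : Disjoint ({a, g a} : Finset V) S := by simp [haS, hgaS]
      refine ⟨{a, g a} ∪ S, 2 + y, ?_, (D.edge (hadj a ha)).union hD hdis, ?_⟩
      · apply union_subset
        · intro b hb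
          simp only [mem_insert, mem_singleton] at hb
          rcases hb with rfl | rfl
          · exact mem_union_left _ ha
          · exact mem_union_right _ (mem_image_of_mem _ ha)
        · exact hS.trans (union_subset_union hss (image_subset_image hss))
      · rw [card_union_of_disjoint hdis, card_pair hne]
        have h1 := card_erase_add_one ha
        have h2 := pred_card_le_card_erase (s := A.erase a) (a := g a)
        omega
    · push Not at hst
      have himg : A = A.image g := eq_of_subset_of_card_le hst card_image_le
      have hmaps : ∀ a ∈ A, g a ∈ A := fun a ha => by
        rw [himg]; exact mem_image_of_mem _ ha
      obtain ⟨a, ha⟩ := nonempty_iff_ne_empty.2 hE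
      let g' : A → A := fun b => ⟨g b, hmaps b b.2⟩
      have hg' : Function.Injective g' := by
        intro b c hbc
        exact Subtype.ext (hinj b.2 c.2 (congrArg Subtype.val hbc))
      have hper := hg'.mem_periodicPts ⟨a, ha⟩
      set c := Function.minimalPeriod g' ⟨a, ha⟩ with hc
      have hcpos : 0 < c := Function.minimalPeriod_pos_of_mem_periodicPts hper
      let h : ℕ → V := fun i => (g'^[i] ⟨a, ha⟩ : A)
      have hA : ∀ i, h i ∈ A := fun i => (g'^[i] ⟨a, ha⟩).2
      have hsucc : ∀ i, h (i + 1) = g (h i) := fun i => by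
        simp only [h, Function.iterate_succ_apply', g']
      have hmod : ∀ i, h (i % c) = h i := fun i => by
        simp only [h, hc, Function.iterate_mod_minimalPeriod_eq]
      have hhinj : Set.InjOn h (Set.Iio c) := by
        intro i hi j hj hij
        exact Function.iterate_injOn_Iio_minimalPeriod hi hj (Subtype.ext hij)
      have hhadj : ∀ i, H.Adj (h i) (h (i + 1)) := fun i => by
        rw [hsucc]; exact hadj _ (hA i)
      set O := (range c).image h with hO
      have hOmem : ∀ i, h i ∈ O := fun i => by
        rw [← hmod]
        exact mem_image_of_mem _ (mem_range.2 (Nat.mod_lt _ hcpos))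
      have hOA : O ⊆ A := by
        intro b hb
        obtain ⟨i, _, rfl⟩ := mem_image.1 hb
        exact hA i
      have hOc : O.card = c := by
        rw [hO, card_image_of_injOn (by simpa using hhinj), card_range]
      have hback : ∀ b ∈ A, g b ∈ O → b ∈ O := by
        intro b hb hgb
        obtain ⟨i, _, hi⟩ := mem_image.1 hgb
        have h1 : h i = g (h (i + (c - 1))) := by
          rw [← hsucc, ← hmod, ← hmod (i + (c - 1) + 1)]
          congr 1
          rw [show i + (c - 1) + 1 = i + c by omega, Nat.add_mod_right]
        have : b = h (i + (c - 1)) := hinj hb (hA _) (by rw [← hi, h1])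
        rw [this]
        exact hOmem _
      have hDO : D H O c := by
        rcases Nat.even_or_odd c with ⟨m, hm⟩ | hodd
        · have hm2 : c = 2 * m := by omega
          have := D.path (H := H) h m (by rw [← hm2]; exact hhinj) (fun i _ => hhadj i)
          rw [← hm2] at this
          exact this
        · have hne1 : c ≠ 1 := by
            intro h1
            have := hhadj 0
            rw [← hmod (0 + 1), ← hmod 0, h1] at this
            simp at this
          have hc3 : 3 ≤ c := by
            obtain ⟨m, hm⟩ := hodd
            omega
          have : NeZero c := ⟨by omega⟩
          have hcast : ∀ k : ℕ, h ((k : ZMod c).val) = h k := fun k => by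
            rw [ZMod.val_natCast, hmod]
          have hcyc : IsCyc H O := by
            refine ⟨c, fun z => h z.val, hodd, hc3, ?_, ?_, ?_, hOc⟩
            · intro y z hyz
              exact ZMod.val_injective c (hhinj (ZMod.val_lt y) (ZMod.val_lt z) hyz)
            · intro z
              have h1 := hcast (z.val + 1)
              push_cast at h1
              rw [ZMod.natCast_zmod_val] at h1
              simp only [h1]
              exact hhadj _
            · ext b
              constructor
              · intro hb
                obtain ⟨i, _, rfl⟩ := mem_image.1 (mem_coe.1 hb)
                exact ⟨(i : ZMod c), hcast i⟩
              · rintro ⟨z, rfl⟩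
                exact hOmem _
          have := D.cyc hcyc (disjoint_empty_right _) D.empty
          simpa [hOc] using this
      obtain ⟨S, y, hS, hD, hy⟩ := ih (A \ O)
        (sdiff_ssubset hOA ⟨h 0, hOmem 0⟩)
        (hinj.mono (by exact_mod_cast sdiff_subset)) (fun b hb => hadj b (sdiff_subset hb))
      have hSsub : S ⊆ A \ O := by
        refine hS.trans (union_subset (Subset.refl _) ?_)
        intro b hb
        obtain ⟨b', hb', rfl⟩ := mem_image.1 hb
        rw [mem_sdiff] at hb' ⊢
        exact ⟨hmaps _ hb'.1, fun h => hb'.2 (hback _ hb'.1 h)⟩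
      have hdis : Disjoint O S := disjoint_of_subset_right hSsub disjoint_sdiff
      refine ⟨O ∪ S, c + y, ?_, hDO.union hD hdis, ?_⟩
      · exact (union_subset hOA (hSsub.trans sdiff_subset)).trans subset_union_left
      · rw [card_union_of_disjoint hdis, hOc]
        have := card_sdiff_add_card_eq_card hOA
        omega

/-- Nonnegative covers of `S` supported on edges. -/
lemma D.cover {S : Finset V} {x : ℕ} (h : D H S x) : ∃ ψ : Sym2 V → ℝ, (∀ e, 0 ≤ ψ e) ∧
    (∀ e, e ∉ H.edgeSet → ψ e = 0) ∧ (∀ v ∈ S, 1 ≤ ∑ e : Sym2 V, if v ∈ e then ψ e else 0) ∧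
    ∑ e : Sym2 V, ψ e = x / 2 := by
  have comb : ∀ {A S : Finset V} {a x : ℕ},
      (∃ ψ : Sym2 V → ℝ, (∀ e, 0 ≤ ψ e) ∧
        (∀ e, e ∉ H.edgeSet → ψ e = 0) ∧
        (∀ v ∈ A, 1 ≤ ∑ e : Sym2 V, if v ∈ e then ψ e else 0) ∧ ∑ e : Sym2 V, ψ e = a / 2) →
      (∃ ψ : Sym2 V → ℝ, (∀ e, 0 ≤ ψ e) ∧
        (∀ e, e ∉ H.edgeSet → ψ e = 0) ∧
        (∀ v ∈ S, 1 ≤ ∑ e : Sym2 V, if v ∈ e then ψ e else 0) ∧ ∑ e : Sym2 V, ψ e = x / 2) →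
      ∃ ψ : Sym2 V → ℝ, (∀ e, 0 ≤ ψ e) ∧
        (∀ e, e ∉ H.edgeSet → ψ e = 0) ∧
        (∀ v ∈ A ∪ S, 1 ≤ ∑ e : Sym2 V, if v ∈ e then ψ e else 0) ∧
        ∑ e : Sym2 V, ψ e = ((a + x : ℕ) : ℝ) / 2 := by
    rintro A S a x ⟨p, p1, p2, p3, p4⟩ ⟨q, q1, q2, q3, q4⟩
    refine ⟨fun e => p e + q e, fun e => add_nonneg (p1 e) (q1 e), fun e he => by
      simp [p2 e he, q2 e he], ?_, ?_⟩
    · intro v hv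
      rcases mem_union.1 hv with hv | hv
      · refine (p3 v hv).trans (sum_le_sum fun e _ => ?_)
        split_ifs
        · linarith [q1 e]
        · rfl
      · refine (q3 v hv).trans (sum_le_sum fun e _ => ?_)
        split_ifs
        · linarith [p1 e]
        · rfl
    · rw [sum_add_distrib, p4, q4]
      push_cast
      ring
  induction h with
  | empty => exact ⟨0, by simp⟩
  | @cyc S A x hA _ _ ih =>
    refine comb ?_ ih
    obtain ⟨c, f, hodd, h3, hinj, hadj, hr, hc⟩ := hA
    have : NeZero c := ⟨by omega⟩
    refine ⟨fun e => ∑ i : ZMod c, if e = s(f i, f (i + 1)) then (1 / 2 : ℝ) else 0, ?_, ?_, ?_, ?_⟩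
    · intro e
      refine sum_nonneg fun i _ => ?_
      split_ifs <;> norm_num
    · intro e he
      refine sum_eq_zero fun i _ => ?_
      rw [if_neg]
      rintro rfl
      exact he (hadj i)
    · intro v hv
      rw [← mem_coe, hr] at hv
      obtain ⟨a, rfl⟩ := hv
      have h1 : ∀ e : Sym2 V, (if f a ∈ e then
          ∑ i : ZMod c, (if e = s(f i, f (i + 1)) then (1 / 2 : ℝ) else 0) else 0)
          = ∑ i : ZMod c, if e = s(f i, f (i + 1)) then
            (if f a ∈ s(f i, f (i + 1)) then (1 / 2 : ℝ) else 0) else 0 := by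
        intro e
        split_ifs with he
        · refine sum_congr rfl fun i _ => ?_
          split_ifs with h1 h2
          · rfl
          · subst h1; exact absurd he h2
          · rfl
        · symm
          refine sum_eq_zero fun i _ => ?_
          split_ifs with h1 h2
          · subst h1; exact absurd h2 he
          · rfl
          · rfl
      simp only [h1]
      rw [sum_comm]
      simp only [sum_ite_eq', mem_univ, if_true, sum_ite_eq]
      have hne : a ≠ a - 1 := by
        intro h
        have h10 : (1 : ZMod c) = 0 := by
          have := sub_eq_self.1 h.symm
          exact this
        have : Fact (1 < c) := ⟨by omega⟩
        exact one_ne_zero h10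
      calc (1 : ℝ) = ∑ i ∈ ({a, a - 1} : Finset (ZMod c)),
            (if f a ∈ s(f i, f (i + 1)) then (1 / 2 : ℝ) else 0) := by
            rw [sum_pair hne]; simp; norm_num
        _ ≤ _ := sum_le_sum_of_subset_of_nonneg (subset_univ _) (fun i _ _ => by
            split_ifs <;> norm_num)
    · rw [sum_comm]
      simp [ZMod.card, hc]
      ring
  | @star S A x hA _ _ ih =>
    refine comb ?_ ih
    obtain ⟨c, L, rfl, hcL, hL, hadj⟩ := hA
    refine ⟨fun e => ∑ w ∈ L, if e = s(c, w) then (1 : ℝ) else 0, ?_, ?_, ?_, ?_⟩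
    · intro e
      refine sum_nonneg fun i _ => ?_
      split_ifs <;> norm_num
    · intro e he
      refine sum_eq_zero fun w hw => ?_
      rw [if_neg]
      rintro rfl
      exact he (hadj w hw)
    · intro v hv
      have : ∃ w ∈ L, v ∈ s(c, w) := by
        rcases mem_insert.1 hv with rfl | hv
        · obtain ⟨w, hw⟩ := hL
          exact ⟨w, hw, by simp⟩
        · exact ⟨v, hv, by simp⟩
      obtain ⟨w, hw, hvw⟩ := this
      have hnn : ∀ e : Sym2 V, ∀ w ∈ L, (0 : ℝ) ≤ if e = s(c, w) then (1 : ℝ) else 0 := by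
        intro e w _
        split_ifs <;> norm_num
      calc (1 : ℝ) ≤ if v ∈ s(c, w) then
            ∑ w' ∈ L, (if s(c, w) = s(c, w') then (1 : ℝ) else 0) else 0 := by
            rw [if_pos hvw]
            calc (1 : ℝ) = (if s(c, w) = s(c, w) then (1 : ℝ) else 0) := by simp
              _ ≤ _ := single_le_sum (f := fun w' => if s(c, w) = s(c, w') then (1 : ℝ) else 0)
                  (hnn _) hw
        _ ≤ _ := single_le_sum (f := fun e => if v ∈ e then
            ∑ w' ∈ L, (if e = s(c, w') then (1 : ℝ) else 0) else 0) (fun e _ => by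
              split_ifs
              · exact sum_nonneg (hnn e)
              · rfl) (mem_univ _)
    · rw [sum_comm]
      simp [card_insert_of_notMem hcL]

lemma D.family {S : Finset V} {x : ℕ} (h : D H S x) : ∃ C T : Finset (Finset V),
    (∀ A ∈ C, IsCyc H A) ∧ (∀ A ∈ T, IsStar H A) ∧ Disjoint C T ∧
    (∀ A ∈ C ∪ T, A ⊆ S) ∧ (∀ v ∈ S, ∃ A ∈ C ∪ T, v ∈ A) ∧
    (∀ A ∈ C ∪ T, ∀ B ∈ C ∪ T, A ≠ B → Disjoint A B) ∧
    ∑ A ∈ C, A.card + ∑ A ∈ T, 2 * (A.card - 1) = x := by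
  induction h with
  | empty => exact ⟨∅, ∅, by simp⟩
  | @cyc S A x hA hAS _ ih =>
    obtain ⟨C, T, h1, h2, h3, h4, h5, h6, h7⟩ := ih
    have hne : A.Nonempty := by
      obtain ⟨c, f, _, h3, _, _, _, hc⟩ := hA
      exact card_pos.1 (by omega)
    have hAn : A ∉ C ∪ T := fun h => by
      obtain ⟨v, hv⟩ := hne
      exact disjoint_left.1 hAS hv (h4 A h hv)
    have hd : ∀ B ∈ C ∪ T, Disjoint A B := fun B hB => disjoint_of_subset_right (h4 B hB) hAS
    have hAn' := hAn
    rw [mem_union, not_or] at hAn'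
    refine ⟨insert A C, T, ?_, h2, ?_, ?_, ?_, ?_, ?_⟩
    · simpa [hA] using h1
    · simp [hAn'.2, h3]
    · rw [insert_union]
      intro B hB
      rcases mem_insert.1 hB with rfl | hB
      · exact subset_union_left
      · exact (h4 B hB).trans subset_union_right
    · rw [insert_union]
      intro v hv
      rcases mem_union.1 hv with hv | hv
      · exact ⟨A, mem_insert_self _ _, hv⟩
      · obtain ⟨B, hB, hvB⟩ := h5 v hv
        exact ⟨B, mem_insert_of_mem hB, hvB⟩
    · rw [insert_union]
      intro B hB0 B' hB0' hBB
      rcases mem_insert.1 hB0 with rfl | hB <;> rcases mem_insert.1 hB0' with rfl | hB'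
      · exact absurd rfl hBB
      · exact hd _ hB'
      · exact (hd _ hB).symm
      · exact h6 _ hB _ hB' hBB
    · rw [sum_insert hAn'.1]
      omega
  | @star S A x hA hAS _ ih =>
    obtain ⟨C, T, h1, h2, h3, h4, h5, h6, h7⟩ := ih
    have hne : A.Nonempty := by
      obtain ⟨c, L, rfl, _⟩ := hA
      simp
    have hAn : A ∉ C ∪ T := fun h => by
      obtain ⟨v, hv⟩ := hne
      exact disjoint_left.1 hAS hv (h4 A h hv)
    have hd : ∀ B ∈ C ∪ T, Disjoint A B := fun B hB => disjoint_of_subset_right (h4 B hB) hAS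
    have hAn' := hAn
    rw [mem_union, not_or] at hAn'
    refine ⟨C, insert A T, h1, ?_, ?_, ?_, ?_, ?_, ?_⟩
    · simpa [hA] using h2
    · simp [hAn'.1, h3]
    · rw [union_insert]
      intro B hB
      rcases mem_insert.1 hB with rfl | hB
      · exact subset_union_left
      · exact (h4 B hB).trans subset_union_right
    · rw [union_insert]
      intro v hv
      rcases mem_union.1 hv with hv | hv
      · exact ⟨A, mem_insert_self _ _, hv⟩
      · obtain ⟨B, hB, hvB⟩ := h5 v hv
        exact ⟨B, mem_insert_of_mem hB, hvB⟩
    · rw [union_insert]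
      intro B hB0 B' hB0' hBB
      rcases mem_insert.1 hB0 with rfl | hB <;> rcases mem_insert.1 hB0' with rfl | hB'
      · exact absurd rfl hBB
      · exact hd _ hB'
      · exact (hd _ hB).symm
      · exact h6 _ hB _ hB' hBB
    · rw [sum_insert hAn'.2]
      omega

open Classical in
/-- Deficiency version of Hall's theorem for neighborhoods. -/
lemma hall (H : SimpleGraph V) : ∃ (d : ℕ) (S N A : Finset V) (g : V → V),
    (∀ u ∈ S, ∀ v, H.Adj u v → v ∈ N) ∧ N.card + d = S.card ∧ (∀ a ∈ A, H.Adj a (g a)) ∧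
    Set.InjOn g A ∧ Fintype.card V ≤ A.card + d := by
  let nb : V → Finset V := fun v => univ.filter (H.Adj v)
  obtain ⟨S, -, hS⟩ := exists_max_image (univ : Finset (Finset V))
    (fun S => (S.card : ℤ) - ((S.biUnion nb).card : ℤ)) ⟨∅, mem_univ _⟩
  have h0 := hS ∅ (mem_univ _)
  simp only [card_empty, biUnion_empty, Nat.cast_zero, sub_zero] at h0
  obtain ⟨d, hd⟩ : ∃ d : ℕ, (S.biUnion nb).card + d = S.card :=
    ⟨S.card - (S.biUnion nb).card, by omega⟩
  let t : V → Finset (V ⊕ Fin d) := fun v => (nb v).disjSum univ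
  have ht : ∀ s : Finset V, s.card ≤ (s.biUnion t).card := by
    intro s
    rcases s.eq_empty_or_nonempty with rfl | ⟨a, ha⟩
    · simp
    · have : s.biUnion t = (s.biUnion nb).disjSum univ := by
        ext x
        rcases x with x | x
        · simp [t]
        · simp only [t, mem_biUnion, inr_mem_disjSum, mem_univ, and_true, iff_true]
          exact ⟨a, ha⟩
      rw [this, card_disjSum, card_univ, Fintype.card_fin]
      have := hS s (mem_univ _)
      omega
  obtain ⟨F, hF, hFt⟩ := (all_card_le_biUnion_card_iff_exists_injective t).1 ht
  let A : Finset V := univ.filter fun v => (F v).isLeft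
  let g : V → V := fun v => (F v).elim id (fun _ => v)
  have hg : ∀ v ∈ A, F v = Sum.inl (g v) := by
    intro v hv
    have hv : (F v).isLeft := by simpa [A] using hv
    simp only [g]
    rcases hw : F v with w | w
    · simp
    · simp [hw] at hv
  refine ⟨d, S, S.biUnion nb, A, g, ?_, hd, ?_, ?_, ?_⟩
  · intro u hu v huv
    exact mem_biUnion.2 ⟨u, hu, by simpa [nb] using huv⟩
  · intro a ha
    have := hFt a
    rw [hg a ha] at this
    simpa [t, nb] using this
  · intro a ha b hb hab
    apply hF
    rw [hg a ha, hg b hb, hab]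
  · have h1 : Aᶜ.card ≤ d := by
      have : (Aᶜ.image F).card ≤ ((univ : Finset (Fin d)).image (Sum.inr : Fin d → V ⊕ Fin d)).card := by
        apply card_le_card
        intro x hx
        obtain ⟨v, hv, rfl⟩ := mem_image.1 hx
        have hv : ¬ (F v).isLeft := by simpa [A] using hv
        rcases hw : F v with w | w
        · simp [hw] at hv
        · simp
      rw [card_image_of_injective _ hF] at this
      refine this.trans (card_image_le.trans ?_)
      simp
    rw [card_compl] at h1
    omega

lemma lower {S N : Finset V} {d : ℕ} (hSN : ∀ u ∈ S, ∀ v, H.Adj u v → v ∈ N)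
    (hd : N.card + d = S.card) (ψ : Sym2 V → ℝ) (h0 : ∀ e, 0 ≤ ψ e)
    (h1 : ∀ e, e ∉ H.edgeSet → ψ e = 0)
    (h2 : ∀ v : V, 1 ≤ ∑ e : Sym2 V, if v ∈ e then ψ e else 0) :
    ((Fintype.card V : ℝ) + d) / 2 ≤ ∑ e : Sym2 V, ψ e := by
  let y : V → ℝ := fun v => (1 + (if v ∈ S then 1 else 0) - (if v ∈ N then 1 else 0)) / 2
  have hy0 : ∀ v, 0 ≤ y v := by
    intro v
    simp only [y]
    split_ifs <;> norm_num
  have hsum : ∑ v, y v = ((Fintype.card V : ℝ) + d) / 2 := by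
    simp only [y]
    rw [← sum_div, sum_sub_distrib, sum_add_distrib]
    have : (N.card : ℝ) + d = S.card := by exact_mod_cast hd
    simp
    linarith
  rw [← hsum]
  calc ∑ v, y v ≤ ∑ v, y v * ∑ e : Sym2 V, (if v ∈ e then ψ e else 0) :=
        sum_le_sum fun v _ => le_mul_of_one_le_right (hy0 v) (h2 v)
    _ = ∑ e : Sym2 V, ψ e * ∑ v, (if v ∈ e then y v else 0) := by
        simp only [mul_sum]
        rw [sum_comm]
        refine sum_congr rfl fun e _ => sum_congr rfl fun v _ => ?_
        split_ifs <;> ring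
    _ ≤ ∑ e : Sym2 V, ψ e := by
        refine sum_le_sum fun e _ => ?_
        by_cases he : e ∈ H.edgeSet
        · refine mul_le_of_le_one_right (h0 e) ?_
          induction e with
          | _ a b =>
            have hab : H.Adj a b := he
            have : ∑ v, (if v ∈ s(a, b) then y v else 0) = y a + y b := by
              rw [← sum_filter, ← sum_pair hab.ne]
              congr 1
              ext v
              simp
            rw [this]
            have ha := hSN a
            have hb := hSN b
            simp only [y]
            have k1 : a ∈ S → b ∈ N := fun h => hSN a h b hab
            have k2 : b ∈ S → a ∈ N := fun h => hSN b h a hab.symm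
            by_cases q1 : a ∈ S <;> by_cases q2 : b ∈ S <;> by_cases q3 : a ∈ N <;>
              by_cases q4 : b ∈ N <;> simp_all <;> norm_num
        · simp [h1 e he]

lemma trunc (ψ : Sym2 V → ℝ) (h0 : ∀ e, 0 ≤ ψ e) (v : V)
    (h2 : 1 ≤ ∑ e : Sym2 V, if v ∈ e then ψ e else 0) :
    1 ≤ ∑ e : Sym2 V, if v ∈ e then min (ψ e) 1 else 0 := by
  by_cases hb : ∃ e, v ∈ e ∧ 1 ≤ ψ e
  · obtain ⟨e, he, h1⟩ := hb
    calc (1 : ℝ) = if v ∈ e then min (ψ e) 1 else 0 := by rw [if_pos he, min_eq_right h1]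
      _ ≤ _ := single_le_sum (f := fun e => if v ∈ e then min (ψ e) 1 else 0) (fun e _ => by
          split_ifs
          · exact le_min (h0 e) zero_le_one
          · rfl) (mem_univ _)
  · push Not at hb
    refine h2.trans (le_of_eq (sum_congr rfl fun e _ => ?_))
    split_ifs with h
    · rw [min_eq_left (hb e h).le]
    · rfl

lemma main (H : SimpleGraph V) (hiso : ∀ v : V, ∃ u, H.Adj v u) :
    ∃ x : ℕ, D H univ x ∧ fracEdgeCoverNum H = x / 2 := by
  obtain ⟨d, S, N, A, g, hSN, hd, hadj, hinj, hcard⟩ := hall H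
  obtain ⟨S0, y, -, hD, hy⟩ := matching (H := H) g A hinj hadj
  obtain ⟨x, hx, hDx⟩ := hD.extend hiso _ rfl
  refine ⟨x, hDx, ?_⟩
  have hxn : x ≤ Fintype.card V + d := by
    rw [card_compl] at hx
    have := card_le_univ S0
    omega
  have hxr : (x : ℝ) ≤ Fintype.card V + d := by exact_mod_cast hxn
  obtain ⟨ψ, p0, p1, p2, p3⟩ := hDx.cover
  have hmem : (∑ e, min (ψ e) 1) ∈ {x : ℝ | ∃ ψ : Sym2 V → ℝ, (∀ e, 0 ≤ ψ e ∧ ψ e ≤ 1) ∧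
    (∀ e, e ∉ H.edgeSet → ψ e = 0) ∧
    (∀ v : V, 1 ≤ ∑ e : Sym2 V, if v ∈ e then ψ e else 0) ∧
    x = ∑ e : Sym2 V, ψ e} := by
    refine ⟨fun e => min (ψ e) 1, fun e => ⟨le_min (p0 e) zero_le_one, min_le_right _ _⟩,
      fun e he => by simp [p1 e he], fun v => trunc ψ p0 v (p2 v (mem_univ _)), rfl⟩
  have hlow : ∀ z ∈ {x : ℝ | ∃ ψ : Sym2 V → ℝ, (∀ e, 0 ≤ ψ e ∧ ψ e ≤ 1) ∧
    (∀ e, e ∉ H.edgeSet → ψ e = 0) ∧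
    (∀ v : V, 1 ≤ ∑ e : Sym2 V, if v ∈ e then ψ e else 0) ∧
    x = ∑ e : Sym2 V, ψ e}, ((Fintype.card V : ℝ) + d) / 2 ≤ z := by
    rintro z ⟨φ, q0, q1, q2, rfl⟩
    exact lower hSN hd φ (fun e => (q0 e).1) q1 q2
  unfold fracEdgeCoverNum
  apply le_antisymm
  · refine (csInf_le ⟨_, hlow⟩ hmem).trans ?_
    rw [← p3]
    exact sum_le_sum fun e _ => min_le_left _ _
  · refine le_trans ?_ (le_csInf ⟨_, hmem⟩ hlow)
    linarith

end EC

/-- Every graph without isolated vertices admits a spanning decomposition of its vertex set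
into vertex-disjoint odd cycles (given by injective cyclic maps `f i : ZMod (c i) → V`, all
cycle edges being edges of `H`) and stars (center `ctr j` with `s j ≥ 1` leaves, all star
edges being edges of `H`), covering every vertex exactly once, such that
`ρ(H) = ∑ ρ(C̄ᵢ) + ∑ ρ(S̄ⱼ) = ∑ cᵢ/2 + ∑ sⱼ` (using `ρ(C_{2k+1}) = k + 1/2` and
`ρ(S_k) = k`). -/
theorem stmt_6 {V : Type*} [Fintype V] [DecidableEq V] (H : SimpleGraph V)
    (hiso : ∀ v : V, ∃ u, H.Adj v u) :
    ∃ (α β : ℕ) (c : Fin α → ℕ) (s : Fin β → ℕ)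
      (f : ∀ i : Fin α, ZMod (c i) → V) (ctr : Fin β → V) (leaves : Fin β → Finset V),
      (∀ i, Odd (c i) ∧ 3 ≤ c i) ∧
      (∀ j, 1 ≤ s j) ∧
      (∀ i, Function.Injective (f i)) ∧
      (∀ i a, H.Adj (f i a) (f i (a + 1))) ∧
      (∀ j, (leaves j).card = s j ∧ ctr j ∉ leaves j ∧ ∀ w ∈ leaves j, H.Adj (ctr j) w) ∧
      Pairwise (Function.onFun Disjoint
        (Sum.elim (fun i => Set.range (f i))
          (fun j => insert (ctr j) (↑(leaves j) : Set V)))) ∧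
      (⋃ p : Fin α ⊕ Fin β, Sum.elim (fun i => Set.range (f i))
          (fun j => insert (ctr j) (↑(leaves j) : Set V)) p) = Set.univ ∧
      fracEdgeCoverNum H = (∑ i, (c i : ℝ) / 2) + ∑ j, (s j : ℝ) := by
  obtain ⟨x, hD, hx⟩ := EC.main H hiso
  obtain ⟨C, T, hC, hT, hCT, -, hcov, hdis, hsum⟩ := hD.family
  have hC' : ∀ i : Fin C.card, EC.IsCyc H (C.equivFin.symm i : Finset V) :=
    fun i => hC _ (C.equivFin.symm i).2
  have hT' : ∀ j : Fin T.card, EC.IsStar H (T.equivFin.symm j : Finset V) :=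
    fun j => hT _ (T.equivFin.symm j).2
  choose c f hodd h3 hinj hadj hr hc using hC'
  choose ctr L hL hcL hLne hLadj using hT'
  have hL' : ∀ j, (insert (ctr j) (↑(L j) : Set V)) = ((T.equivFin.symm j : Finset V) : Set V) := by
    intro j
    rw [hL j, Finset.coe_insert]
  have hfam : (Sum.elim (fun i => Set.range (f i))
      (fun j => insert (ctr j) (↑(L j) : Set V))) =
      fun p => ((Sum.elim (fun i => (C.equivFin.symm i : Finset V))
        (fun j => (T.equivFin.symm j : Finset V)) p : Finset V) : Set V) := by
    funext p
    rcases p with i | j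
    · simp only [Sum.elim_inl, hr]
    · simp only [Sum.elim_inr, hL']
  refine ⟨C.card, T.card, c, fun j => (L j).card, f, ctr, L, fun i => ⟨hodd i, h3 i⟩,
    fun j => Finset.card_pos.2 (hLne j), hinj, hadj, fun j => ⟨rfl, hcL j, hLadj j⟩, ?_, ?_, ?_⟩
  · rw [hfam]
    have hm : ∀ p : Fin C.card ⊕ Fin T.card, (Sum.elim (fun i => (C.equivFin.symm i : Finset V))
        (fun j => (T.equivFin.symm j : Finset V)) p : Finset V) ∈ C ∪ T := by
      rintro (i | j)
      · exact Finset.mem_union_left _ (C.equivFin.symm i).2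
      · exact Finset.mem_union_right _ (T.equivFin.symm j).2
    intro p q hpq
    simp only [Function.onFun, Finset.disjoint_coe]
    refine hdis _ (hm p) _ (hm q) fun h => hpq ?_
    rcases p with i | i <;> rcases q with j | j
    · simp only [Sum.elim_inl] at h
      rw [C.equivFin.symm.injective (Subtype.ext h)]
    · simp only [Sum.elim_inl, Sum.elim_inr] at h
      exact absurd (h ▸ (T.equivFin.symm j).2)
        (Finset.disjoint_left.1 hCT (C.equivFin.symm i).2)
    · simp only [Sum.elim_inl, Sum.elim_inr] at h
      exact absurd (h ▸ (T.equivFin.symm i).2)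
        (Finset.disjoint_left.1 hCT (C.equivFin.symm j).2)
    · simp only [Sum.elim_inr] at h
      rw [T.equivFin.symm.injective (Subtype.ext h)]
  · rw [hfam, Set.eq_univ_iff_forall]
    intro v
    obtain ⟨A, hA, hv⟩ := hcov v (Finset.mem_univ v)
    rw [Set.mem_iUnion]
    rcases Finset.mem_union.1 hA with h | h
    · exact ⟨Sum.inl (C.equivFin ⟨A, h⟩), by simpa using hv⟩
    · exact ⟨Sum.inr (T.equivFin ⟨A, h⟩), by simpa using hv⟩
  · have e1 : ∑ i, c i = ∑ A ∈ C, A.card := by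
      rw [← Finset.sum_coe_sort C, ← Equiv.sum_comp C.equivFin.symm]
      exact Finset.sum_congr rfl fun i _ => (hc i).symm
    have e2 : ∑ j, 2 * (L j).card = ∑ A ∈ T, 2 * (A.card - 1) := by
      rw [← Finset.sum_coe_sort T, ← Equiv.sum_comp T.equivFin.symm]
      refine Finset.sum_congr rfl fun j _ => ?_
      rw [hL j, Finset.card_insert_of_notMem (hcL j)]
      simp
    rw [hx, ← hsum, ← e1, ← e2, ← Finset.sum_div, ← Finset.mul_sum]
    push_cast
    ring
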